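/- Fix l ∈ ℝ with |l| < 1. Consider the directed graph whose vertices are the pure quaternions of norm 1, with a directed edge from b to c whenever ⟨b,c⟩ = l. Then this graph is connected and of finite diameter: there exists a natural number N (depending only on l) such that for all pure quaternions b, c of norm 1 there is a finite sequence b = x₀, x₁, …, x_m = c of pure quaternions of norm 1 with m ≤ N and ⟨x_i, x_{i+1}⟩ = l for all 0 ≤ i < m. (This is Lemma 6.6 of the paper in the case k = ℝ, 𝔹 = ℍ.) -/

import Mathlib

open Quaternion
open scoped RealInnerProductSpace

lemma psg_exists_orth (u v : ℍ[ℝ]) :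
    ∃ f : ℍ[ℝ], f.re = 0 ∧ ‖f‖ = 1 ∧ ⟪u, f⟫ = 0 ∧ ⟪v, f⟫ = 0 := by
  let L : ℍ[ℝ] →ₗ[ℝ] (Fin 3 → ℝ) :=
    LinearMap.pi ![(innerₗ ℍ[ℝ] (1 : ℍ[ℝ])), (innerₗ ℍ[ℝ] u), (innerₗ ℍ[ℝ] v)]
  have h : LinearMap.ker L ≠ ⊥ := by
    apply LinearMap.ker_ne_bot_of_finrank_lt
    rw [Quaternion.finrank_eq_four]
    simp
  obtain ⟨w, hw, hw0⟩ := (Submodule.ne_bot_iff _).1 h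
  rw [LinearMap.mem_ker] at hw
  have h0 : ⟪(1 : ℍ[ℝ]), w⟫ = 0 := congrFun hw 0
  have h1 : ⟪u, w⟫ = 0 := congrFun hw 1
  have h2 : ⟪v, w⟫ = 0 := congrFun hw 2
  have h0' : w.re = 0 := by
    rw [Quaternion.inner_def] at h0
    simpa using h0
  refine ⟨‖w‖⁻¹ • w, ?_, ?_, ?_, ?_⟩
  · simp [h0']
  · rw [norm_smul, norm_inv, norm_norm, inv_mul_cancel₀ (norm_ne_zero_iff.2 hw0)]
  · rw [real_inner_smul_right, h1, mul_zero]
  · rw [real_inner_smul_right, h2, mul_zero]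

lemma psg_norm_one {x : ℍ[ℝ]} (h : ⟪x, x⟫ = 1) : ‖x‖ = 1 := by
  rw [real_inner_self_eq_norm_sq] at h
  have := norm_nonneg x
  nlinarith

lemma psg_inner_one {x : ℍ[ℝ]} (h : ‖x‖ = 1) : ⟪x, x⟫ = 1 := by
  rw [real_inner_self_eq_norm_sq, h, one_pow]

lemma psg_common (l : ℝ) (p q : ℍ[ℝ]) (hp : p.re = 0) (hq : q.re = 0)
    (hp1 : ‖p‖ = 1) (hq1 : ‖q‖ = 1) (h0 : 0 ≤ ⟪p, q⟫) (h1 : 2 * l ^ 2 - 1 ≤ ⟪p, q⟫) :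
    ∃ y : ℍ[ℝ], y.re = 0 ∧ ‖y‖ = 1 ∧ ⟪p, y⟫ = l ∧ ⟪y, q⟫ = l := by
  obtain ⟨f, hf, hf1, hpf, hqf⟩ := psg_exists_orth p q
  have hpp := psg_inner_one hp1
  have hqq := psg_inner_one hq1
  have hff := psg_inner_one hf1
  have hqp : ⟪q, p⟫ = ⟪p, q⟫ := real_inner_comm _ _
  have hfp : ⟪f, p⟫ = 0 := by rw [real_inner_comm, hpf]
  have hfq : ⟪f, q⟫ = 0 := by rw [real_inner_comm, hqf]
  set t := ⟪p, q⟫ with ht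
  have htp : 0 < 1 + t := by linarith
  have hr : 0 ≤ 1 - 2 * l ^ 2 / (1 + t) := by
    rw [sub_nonneg, div_le_one htp]; linarith
  have hs := Real.mul_self_sqrt hr
  set r := √(1 - 2 * l ^ 2 / (1 + t))
  refine ⟨(l / (1 + t)) • (p + q) + r • f, ?_, psg_norm_one ?_, ?_, ?_⟩
  · simp [hp, hq, hf]
  · simp only [inner_add_left, inner_add_right, real_inner_smul_left, real_inner_smul_right,
      hpp, hqq, hff, hpf, hqf, hqp, hfp, hfq, ← ht]
    have : r * (r * 1) = 1 - 2 * l ^ 2 / (1 + t) := by rw [mul_one]; exact hs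
    rw [this]
    field_simp
    ring
  · simp only [inner_add_right, real_inner_smul_right, hpp, hpf, ← ht]
    field_simp
    ring
  · simp only [inner_add_left, real_inner_smul_left, hqq, hfq, ← ht]
    field_simp
    ring

lemma psg_frame (b c : ℍ[ℝ]) (hb : b.re = 0) (hc : c.re = 0) (hb1 : ‖b‖ = 1) (hc1 : ‖c‖ = 1) :
    ∃ (e : ℍ[ℝ]) (φ : ℝ), e.re = 0 ∧ ‖e‖ = 1 ∧ ⟪b, e⟫ = 0 ∧ 0 ≤ φ ∧ φ ≤ Real.pi ∧
      c = Real.cos φ • b + Real.sin φ • e := by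
  have hbb := psg_inner_one hb1
  have hcc := psg_inner_one hc1
  have hcb : ⟪c, b⟫ = ⟪b, c⟫ := real_inner_comm _ _
  have habs : |⟪b, c⟫| ≤ 1 := by simpa [hb1, hc1] using abs_real_inner_le_norm b c
  obtain ⟨hm1, h1⟩ := abs_le.1 habs
  set t := ⟪b, c⟫ with ht
  have hv : ‖c - t • b‖ = √(1 - t ^ 2) := by
    rw [eq_comm, Real.sqrt_eq_iff_mul_self_eq (by nlinarith) (norm_nonneg _), ← real_inner_self_eq_norm_mul_norm]
    simp only [inner_sub_left, inner_sub_right, real_inner_smul_left, real_inner_smul_right,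
      hbb, hcc, hcb, ← ht]
    ring
  by_cases hv0 : c - t • b = 0
  · obtain ⟨e, he, he1, hbe, -⟩ := psg_exists_orth b b
    refine ⟨e, Real.arccos t, he, he1, hbe, Real.arccos_nonneg _, Real.arccos_le_pi _, ?_⟩
    rw [Real.cos_arccos hm1 h1, Real.sin_arccos, ← hv, hv0, norm_zero, zero_smul, add_zero]
    exact sub_eq_zero.1 hv0
  · have hn := norm_ne_zero_iff.2 hv0
    refine ⟨‖c - t • b‖⁻¹ • (c - t • b), Real.arccos t, ?_, ?_, ?_, Real.arccos_nonneg _,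
      Real.arccos_le_pi _, ?_⟩
    · simp [hb, hc]
    · rw [norm_smul, norm_inv, norm_norm, inv_mul_cancel₀ hn]
    · rw [real_inner_smul_right, inner_sub_right, real_inner_smul_right, hbb, ← ht]
      ring
    · rw [Real.cos_arccos hm1 h1, Real.sin_arccos, ← hv, smul_smul, mul_inv_cancel₀ hn, one_smul]
      abel

lemma psg_exists_n (l : ℝ) (hl : |l| < 1) :
    ∃ n : ℕ, 0 < n ∧ 0 ≤ Real.cos (Real.pi / n) ∧ 2 * l ^ 2 - 1 ≤ Real.cos (Real.pi / n) := by
  have hT : Filter.Tendsto (fun n : ℕ => Real.cos (Real.pi / n)) Filter.atTop (nhds 1) := by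
    have := (Real.continuous_cos.tendsto 0).comp (tendsto_const_div_atTop_nhds_zero_nat Real.pi)
    simpa [Function.comp_def] using this
  have hd : 2 * l ^ 2 - 1 < 1 := by
    have := (sq_lt_one_iff_abs_lt_one l).2 hl
    linarith
  obtain ⟨n, ⟨h1, h2⟩, h3⟩ := (((hT.eventually_const_le one_pos).and
    (hT.eventually_const_le hd)).and (Filter.eventually_gt_atTop 0)).exists
  exact ⟨n, h3, h1, h2⟩

/-- Lemma 6.6 of the paper in the case `k = ℝ`, `𝔹 = ℍ`: for `l ∈ ℝ` with
`|l| < 1`, the directed graph on the pure quaternions of norm 1, with an edge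
from `b` to `c` whenever `⟪b, c⟫ = l`, is connected of finite diameter. -/
theorem pure_sphere_graph_connected (l : ℝ) (hl : |l| < 1) :
    ∃ N : ℕ, ∀ b c : ℍ[ℝ],
      b.re = 0 → c.re = 0 → ‖b‖ = 1 → ‖c‖ = 1 →
      ∃ m : ℕ, m ≤ N ∧ ∃ x : ℕ → ℍ[ℝ],
        x 0 = b ∧ x m = c ∧
        (∀ i ≤ m, (x i).re = 0 ∧ ‖x i‖ = 1) ∧
        (∀ i < m, ⟪x i, x (i + 1)⟫ = l) := by
  obtain ⟨n, hn, hn0, hn1⟩ := psg_exists_n l hl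
  refine ⟨2 * n, fun b c hb hc hb1 hc1 => ⟨2 * n, le_rfl, ?_⟩⟩
  obtain ⟨e, φ, he, he1, hbe, hφ0, hφ1, hcφ⟩ := psg_frame b c hb hc hb1 hc1
  have hnR : (0 : ℝ) < n := Nat.cast_pos.2 hn
  have hbb := psg_inner_one hb1
  have hee := psg_inner_one he1
  have heb : ⟪e, b⟫ = 0 := by rw [real_inner_comm, hbe]
  have hcos : Real.cos (Real.pi / n) ≤ Real.cos (φ / n) := by
    apply Real.cos_le_cos_of_nonneg_of_le_pi (by positivity)
    · exact div_le_self Real.pi_pos.le (by exact_mod_cast hn)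
    · gcongr
  let p : ℕ → ℍ[ℝ] := fun k =>
    Real.cos (k * (φ / n)) • b + Real.sin (k * (φ / n)) • e
  have hpi : ∀ j k : ℕ, ⟪p j, p k⟫ = Real.cos (k * (φ / n) - j * (φ / n)) := by
    intro j k
    simp only [p, inner_add_left, inner_add_right, real_inner_smul_left, real_inner_smul_right,
      hbb, hee, hbe, heb, Real.cos_sub]
    ring
  have hpre : ∀ k, (p k).re = 0 := by intro k; simp [p, hb, he]
  have hp1 : ∀ k, ‖p k‖ = 1 := by intro k; apply psg_norm_one; rw [hpi]; simp
  have hps : ∀ k, ⟪p k, p (k + 1)⟫ = Real.cos (φ / n) := by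
    intro k; rw [hpi]; congr 1; push_cast; ring
  have hy : ∀ k, ∃ y : ℍ[ℝ], y.re = 0 ∧ ‖y‖ = 1 ∧ ⟪p k, y⟫ = l ∧ ⟪y, p (k + 1)⟫ = l := by
    intro k
    apply psg_common l _ _ (hpre _) (hpre _) (hp1 _) (hp1 _)
    · rw [hps]; linarith
    · rw [hps]; linarith
  choose y hyre hy1 hyl hyr using hy
  refine ⟨fun i => if i % 2 = 0 then p (i / 2) else y (i / 2), ?_, ?_, ?_, ?_⟩
  · simp [p]
  · have : (n : ℝ) * (φ / n) = φ := by field_simp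
    simp [p, this, hcφ]
  · intro i _
    dsimp only
    split_ifs
    · exact ⟨hpre _, hp1 _⟩
    · exact ⟨hyre _, hy1 _⟩
  · intro i _
    dsimp only
    rcases Nat.mod_two_eq_zero_or_one i with h | h
    · have h2 : (i + 1) % 2 ≠ 0 := by omega
      have h3 : (i + 1) / 2 = i / 2 := by omega
      rw [if_pos h, if_neg h2, h3]
      exact hyl _
    · have h1 : i % 2 ≠ 0 := by omega
      have h2 : (i + 1) % 2 = 0 := by omega
      have h3 : (i + 1) / 2 = i / 2 + 1 := by omega
      rw [if_neg h1, if_pos h2, h3]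
      exact hyr _
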